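/- There exist absolute constants D₀ > 1 and c₀ > 0 such that the following holds: every finite simple graph G on n ≥ 1 vertices that admits a vector 3-coloring and whose average degree D = 2·|E(G)|/n satisfies D ≥ D₀ contains an independent set of size at least c₀·n/(D·ln D)^(1/3). -/

import Mathlib

open MeasureTheory ProbabilityTheory Real
open scoped ENNReal NNReal

lemma sqrt_two_pi_le_three : √(2 * π) ≤ 3 := by
  rw [Real.sqrt_le_left (by norm_num)]
  nlinarith [Real.pi_lt_four]

lemma gaussianPDFReal_le_one {t : ℝ≥0} (ht : 1 ≤ t) (x : ℝ) : gaussianPDFReal 0 t x ≤ 1 := by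
  have ht' : (1 : ℝ) ≤ t := by exact_mod_cast ht
  have h1 : 1 ≤ √(2 * π * t) := by
    rw [Real.one_le_sqrt]
    nlinarith [Real.pi_gt_three]
  rw [gaussianPDFReal_def]
  have h2 : rexp (-(x - 0) ^ 2 / (2 * t)) ≤ 1 := by
    rw [Real.exp_le_one_iff]
    exact div_nonpos_of_nonpos_of_nonneg (by nlinarith [sq_nonneg (x - 0)]) (by positivity)
  exact mul_le_one₀ (inv_le_one_of_one_le₀ h1) (exp_pos _).le h2

/-- A Gaussian of variance at least one puts mass at most `2 * y` on `[-y, y]`. -/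
lemma gaussianReal_abs_le {t : ℝ≥0} (ht : 1 ≤ t) (y : ℝ) :
    gaussianReal 0 t {w | |w| ≤ y} ≤ ENNReal.ofReal (2 * y) := by
  have hset : {w : ℝ | |w| ≤ y} = Set.Icc (-y) y := by
    ext w; simp [abs_le]
  rw [hset, gaussianReal_apply _ (by positivity)]
  calc ∫⁻ x in Set.Icc (-y) y, gaussianPDF 0 t x
      ≤ ∫⁻ _ in Set.Icc (-y) y, 1 := by
        refine lintegral_mono fun x => ?_
        rw [gaussianPDF]
        exact ENNReal.ofReal_le_one.2 (gaussianPDFReal_le_one ht x)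
    _ = ENNReal.ofReal (2 * y) := by
        simp [Real.volume_Icc, two_mul]

lemma le_gaussianReal_Ici {c : ℝ} (hc : 1 ≤ c) :
    rexp (-4) * (rexp (-(c ^ 2 / 2)) / c) ≤ (gaussianReal 0 1).real (Set.Ici c) := by
  have hc0 : 0 < c := by linarith
  have hpdf : ∀ x ∈ Set.Icc c (c + 1 / c),
      rexp (-4) * rexp (-(c ^ 2 / 2)) ≤ gaussianPDFReal 0 1 x := by
    intro x hx
    have hinv : rexp (-(5 / 2)) ≤ (√(2 * π))⁻¹ := by
      rw [Real.exp_neg]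
      refine inv_anti₀ (by positivity) (sqrt_two_pi_le_three.trans ?_)
      linarith [Real.add_one_le_exp (5 / 2 : ℝ)]
    have hx2 : x ^ 2 ≤ c ^ 2 + 3 := by
      have h1 : x ^ 2 ≤ (c + 1 / c) ^ 2 := pow_le_pow_left₀ (hc0.le.trans hx.1) hx.2 2
      have h2 : (c + 1 / c) ^ 2 = c ^ 2 + 2 + (1 / c) ^ 2 := by field_simp; ring
      have h3 : (1 / c) ^ 2 ≤ 1 := pow_le_one₀ (by positivity) ((div_le_one hc0).2 hc)
      linarith
    have he : rexp (-4) * rexp (-(c ^ 2 / 2)) =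
        rexp (-(5 / 2)) * rexp (-(c ^ 2 + 3) / 2) := by
      rw [← Real.exp_add, ← Real.exp_add]; congr 1; ring
    rw [he, gaussianPDFReal_def]
    simp only [NNReal.coe_one, mul_one, sub_zero]
    gcongr
  rw [measureReal_def, gaussianReal_apply_eq_integral _ one_ne_zero,
    ENNReal.toReal_ofReal (integral_nonneg fun x => gaussianPDFReal_nonneg _ _ _)]
  calc rexp (-4) * (rexp (-(c ^ 2 / 2)) / c)
      = ∫ _ in Set.Icc c (c + 1 / c), rexp (-4) * rexp (-(c ^ 2 / 2)) := by
        simp [hc0.le]; ring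
    _ ≤ ∫ x in Set.Icc c (c + 1 / c), gaussianPDFReal 0 1 x :=
        setIntegral_mono_on (integrableOn_const measure_Icc_lt_top.ne) (integrable_gaussianPDFReal _ _).integrableOn
          measurableSet_Icc hpdf
    _ ≤ ∫ x in Set.Ici c, gaussianPDFReal 0 1 x :=
        setIntegral_mono_set (integrable_gaussianPDFReal _ _).integrableOn
          (ae_of_all _ fun x => gaussianPDFReal_nonneg _ _ _)
          (Set.Icc_subset_Ici_self.eventuallyLE)

lemma lintegral_mul_exp_neg_mul {a : ℝ} (ha : 0 < a) :
    ∫⁻ x in Set.Ioi (0 : ℝ), ENNReal.ofReal (x * rexp (-(a * x))) =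
      ENNReal.ofReal (1 / a ^ 2) := by
  have h := Real.integral_rpow_mul_exp_neg_mul_Ioi (a := 2) two_pos ha
  have h2 : ∫ x in Set.Ioi (0 : ℝ), x * rexp (-(a * x)) = 1 / a ^ 2 := by
    norm_num at h
    simpa using h
  rw [← h2, ofReal_integral_eq_lintegral_ofReal]
  · by_contra hcon
    rw [integral_undef hcon] at h2
    have : 0 < 1 / a ^ 2 := by positivity
    linarith
  · exact (ae_restrict_iff' measurableSet_Ioi).2
      (ae_of_all _ fun x hx => mul_nonneg (le_of_lt hx) (exp_pos _).le)

/-- The expected excess of a standard Gaussian over a level `a > 0`. -/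
lemma lintegral_excess_gaussianReal_le {a : ℝ} (ha : 0 < a) :
    ∫⁻ x, ENNReal.ofReal (x - a) ∂gaussianReal 0 1 ≤
      ENNReal.ofReal (rexp (-(a ^ 2 / 2)) / a ^ 2) := by
  rw [gaussianReal_of_var_ne_zero _ one_ne_zero,
    lintegral_withDensity_eq_lintegral_mul _ (measurable_gaussianPDF _ _) (by fun_prop),
    ← lintegral_add_right_eq_self _ a]
  calc ∫⁻ x, (gaussianPDF 0 1 * fun x => ENNReal.ofReal (x - a)) (x + a)
      ≤ ∫⁻ x, (Set.Ioi (0 : ℝ)).indicator (fun x => ENNReal.ofReal (rexp (-(a ^ 2 / 2))) *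
          ENNReal.ofReal (x * rexp (-(a * x)))) x := by
        refine lintegral_mono fun x => ?_
        simp only [Pi.mul_apply, add_sub_cancel_right]
        rcases le_or_gt x 0 with hx | hx
        · simp [ENNReal.ofReal_of_nonpos hx]
        · rw [Set.indicator_of_mem (Set.mem_Ioi.2 hx), gaussianPDF,
            ← ENNReal.ofReal_mul (gaussianPDFReal_nonneg _ _ _),
            ← ENNReal.ofReal_mul (exp_pos _).le]
          refine ENNReal.ofReal_le_ofReal ?_
          have hs : 1 ≤ √(2 * π) := by
            rw [Real.one_le_sqrt]; nlinarith [Real.pi_gt_three]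
          have hp : gaussianPDFReal 0 1 (x + a) ≤ rexp (-(a ^ 2 / 2)) * rexp (-(a * x)) := by
            rw [gaussianPDFReal_def, ← Real.exp_add]
            simp only [NNReal.coe_one, mul_one, sub_zero]
            calc _ ≤ 1 * rexp (-(x + a) ^ 2 / 2) := by
                  gcongr; exact inv_le_one_of_one_le₀ hs
              _ ≤ _ := by
                  rw [one_mul]; gcongr; nlinarith [sq_nonneg x]
          nlinarith [mul_le_mul_of_nonneg_right hp hx.le]
    _ = ENNReal.ofReal (rexp (-(a ^ 2 / 2)) / a ^ 2) := by
        rw [lintegral_indicator measurableSet_Ioi, lintegral_const_mul _ (by fun_prop),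
          lintegral_mul_exp_neg_mul ha, ← ENNReal.ofReal_mul (exp_pos _).le, mul_one_div]

section StdGaussian

variable {E : Type*} [NormedAddCommGroup E] [InnerProductSpace ℝ E] [FiniteDimensional ℝ E]
  [MeasurableSpace E] [BorelSpace E]

lemma map_inner_stdGaussian (u : E) :
    (stdGaussian E).map (fun x => inner ℝ u x) = gaussianReal 0 (‖u‖ ^ 2).toNNReal := by
  have h := IsGaussian.map_eq_gaussianReal (μ := stdGaussian E) (innerSL ℝ u)
  rw [integral_strongDual_stdGaussian, variance_dual_stdGaussian, innerSL_apply_norm] at h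
  exact h

lemma indepFun_inner_stdGaussian {u w : E} (h : inner ℝ u w = 0) :
    IndepFun (fun x => inner ℝ u x) (fun x => inner ℝ w x) (stdGaussian E) := by
  apply HasGaussianLaw.indepFun_of_covariance_eq_zero
  · exact (IsGaussian.hasGaussianLaw_id (μ := stdGaussian E)).map
      ((innerSL ℝ u).prod (innerSL ℝ w))
  · rw [← covarianceBilin_apply_eq_cov IsGaussian.memLp_two_id, covarianceBilin_stdGaussian]
    exact h

/-- Two half-spaces at distance `c` whose unit normals make an angle of at least `120` degrees
have small common Gaussian measure. -/
lemma stdGaussian_inter_halfSpaces_le {u w : E} (hu : ‖u‖ = 1) (hw : ‖w‖ = 1)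
    (huw : inner ℝ u w ≤ -(1 / 2)) {c : ℝ} (hc : 0 < c) :
    stdGaussian E ({x | c ≤ inner ℝ u x} ∩ {x | c ≤ inner ℝ w x}) ≤
      ENNReal.ofReal (rexp (-(2 * c ^ 2)) / c ^ 2) := by
  have hadd : ‖u + w‖ ≤ 1 := by
    have := norm_add_sq_real u w
    rw [hu, hw] at this
    nlinarith [norm_nonneg (u + w)]
  have hsub : 1 ≤ (‖u - w‖ ^ 2).toNNReal := by
    have := norm_sub_sq_real u w
    rw [hu, hw] at this
    rw [Real.one_le_toNNReal]
    linarith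
  have horth : inner ℝ (u + w) (u - w) = 0 := by
    rw [inner_add_left, inner_sub_right, inner_sub_right, real_inner_self_eq_norm_sq,
      real_inner_self_eq_norm_sq, real_inner_comm, hu, hw]
    ring
  have hmap := (indepFun_iff_map_prod_eq_prod_map_map (by fun_prop) (by fun_prop)).1
    (indepFun_inner_stdGaussian horth)
  rw [map_inner_stdGaussian, map_inner_stdGaussian] at hmap
  have hscale : gaussianReal 0 (‖u + w‖ ^ 2).toNNReal =
      (gaussianReal 0 1).map (‖u + w‖ * ·) := by
    rw [gaussianReal_map_const_mul, mul_zero, mul_one]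
    congr 1
    ext
    simp
  have hmeas : MeasurableSet {p : ℝ × ℝ | |p.2| ≤ p.1 - 2 * c} :=
    measurableSet_le (by fun_prop) (by fun_prop)
  calc stdGaussian E ({x | c ≤ inner ℝ u x} ∩ {x | c ≤ inner ℝ w x})
      ≤ stdGaussian E ((fun x => (inner ℝ (u + w) x, inner ℝ (u - w) x)) ⁻¹'
          {p : ℝ × ℝ | |p.2| ≤ p.1 - 2 * c}) := by
        refine measure_mono ?_
        rintro x ⟨h1, h2⟩
        simp only [Set.mem_ofPred_eq, Set.mem_preimage] at h1 h2 ⊢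
        rw [inner_add_left, inner_sub_left, abs_le]
        constructor <;> linarith
    _ = ∫⁻ z, gaussianReal 0 (‖u - w‖ ^ 2).toNNReal {y | |y| ≤ z - 2 * c}
          ∂gaussianReal 0 (‖u + w‖ ^ 2).toNNReal := by
        rw [← Measure.map_apply (by fun_prop) hmeas, hmap, Measure.prod_apply hmeas]
        rfl
    _ ≤ ∫⁻ z, ENNReal.ofReal (2 * (z - 2 * c)) ∂gaussianReal 0 (‖u + w‖ ^ 2).toNNReal :=
        lintegral_mono fun z => gaussianReal_abs_le hsub _
    _ = ∫⁻ z, ENNReal.ofReal (2 * (‖u + w‖ * z - 2 * c)) ∂gaussianReal 0 1 := by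
        rw [hscale, lintegral_map (by fun_prop) (by fun_prop)]
    _ ≤ ∫⁻ z, ENNReal.ofReal 2 * ENNReal.ofReal (z - 2 * c) ∂gaussianReal 0 1 := by
        refine lintegral_mono fun z => ?_
        rw [← ENNReal.ofReal_mul zero_le_two]
        rcases le_or_gt z 0 with hz | hz
        · rw [ENNReal.ofReal_of_nonpos]
          · exact zero_le
          · nlinarith [norm_nonneg (u + w)]
        · exact ENNReal.ofReal_le_ofReal (by nlinarith)
    _ ≤ ENNReal.ofReal (rexp (-(2 * c ^ 2)) / c ^ 2) := by
        rw [lintegral_const_mul _ (by fun_prop)]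
        refine (mul_le_mul_right (lintegral_excess_gaussianReal_le (by positivity)) _).trans ?_
        rw [← ENNReal.ofReal_mul zero_le_two]
        refine ENNReal.ofReal_le_ofReal ?_
        have he : -((2 * c) ^ 2 / 2) = -(2 * c ^ 2) := by ring
        rw [he, mul_div_assoc']
        rw [div_le_div_iff₀ (by positivity) (by positivity)]
        have : 0 < rexp (-(2 * c ^ 2)) * c ^ 2 := by positivity
        nlinarith

end StdGaussian

namespace SimpleGraph

variable {V : Type*} [Fintype V] [LinearOrder V] (G : SimpleGraph V) [DecidableRel G.Adj]

/-- The edges of `G`, written as pairs with the larger endpoint first. -/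
def orderedEdges : Finset (V × V) := Finset.univ.filter fun p => p.2 < p.1 ∧ G.Adj p.1 p.2

lemma card_orderedEdges_le : G.orderedEdges.card ≤ Nat.card G.edgeSet := by
  rw [← Nat.card_eq_finsetCard]
  refine Nat.card_le_card_of_injective
    (fun e : G.orderedEdges => ⟨s(e.1.1, e.1.2), (Finset.mem_filter.1 e.2).2.2⟩) ?_
  rintro ⟨⟨a, b⟩, hab⟩ ⟨⟨a', b'⟩, hab'⟩ h
  have hlt : b < a := (Finset.mem_filter.1 hab).2.1
  have hlt' : b' < a' := (Finset.mem_filter.1 hab').2.1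
  rcases Sym2.eq_iff.1 (congrArg Subtype.val h) with ⟨rfl, rfl⟩ | ⟨rfl, rfl⟩
  · rfl
  · exact absurd hlt hlt'.not_gt

/-- Deleting one endpoint of every edge inside `S` leaves an independent set. -/
lemma exists_independent_subset (S : Finset V) :
    ∃ T : Finset V, (∀ i ∈ T, ∀ j ∈ T, ¬ G.Adj i j) ∧
      S.card ≤ T.card + (G.orderedEdges.filter fun p => p.1 ∈ S ∧ p.2 ∈ S).card := by
  refine ⟨S.filter fun i => ∀ j ∈ S, j < i → ¬ G.Adj i j, ?_, ?_⟩
  · intro i hi j hj hij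
    rw [Finset.mem_filter] at hi hj
    rcases lt_trichotomy i j with h | h | h
    · exact hj.2 i hi.1 h hij.symm
    · exact G.ne_of_adj hij h
    · exact hi.2 j hj.1 h hij
  · rw [← Finset.card_filter_add_card_filter_not (s := S)
      (fun i => ∀ j ∈ S, j < i → ¬ G.Adj i j)]
    gcongr
    refine (Finset.card_le_card ?_).trans (Finset.card_image_le (f := Prod.fst))
    intro i hi
    simp only [Finset.mem_filter, not_forall, not_not] at hi
    obtain ⟨hiS, j, hjS, hji, hadj⟩ := hi
    exact Finset.mem_image.2 ⟨(i, j), by simp [orderedEdges, *], rfl⟩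

/-- First moment method: random vertex subsets with few expected edges yield independent sets. -/
lemma exists_independent_of_events {Ω : Type*} [MeasurableSpace Ω] (μ : Measure Ω)
    [IsProbabilityMeasure μ] (A : V → Set Ω) (hA : ∀ i, MeasurableSet (A i)) {p q : ℝ}
    (hq : 0 ≤ q) (hp : ∀ i, p ≤ μ.real (A i))
    (hpq : ∀ i j, G.Adj i j → μ.real (A i ∩ A j) ≤ q) :
    ∃ T : Finset V, (∀ i ∈ T, ∀ j ∈ T, ¬ G.Adj i j) ∧
      Fintype.card V * p - Nat.card G.edgeSet * q ≤ T.card := by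
  classical
  have hint : ∀ B : Set Ω, MeasurableSet B → Integrable (B.indicator (1 : Ω → ℝ)) μ :=
    fun B hB => (integrable_const 1).indicator hB
  have hvert : Integrable (fun x => ∑ i, (A i).indicator (1 : Ω → ℝ) x) μ :=
    integrable_finsetSum _ fun i _ => hint _ (hA i)
  have hedge : Integrable
      (fun x => ∑ e ∈ G.orderedEdges, (A e.1 ∩ A e.2).indicator (1 : Ω → ℝ) x) μ :=
    integrable_finsetSum _ fun e _ => hint _ ((hA _).inter (hA _))
  obtain ⟨x, hx⟩ := exists_integral_le (hvert.sub hedge)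
  obtain ⟨T, hT, hcard⟩ := G.exists_independent_subset (Finset.univ.filter fun i => x ∈ A i)
  refine ⟨T, hT, ?_⟩
  have hlower : Fintype.card V * p - Nat.card G.edgeSet * q ≤
      ∫ y, ((fun x => ∑ i, (A i).indicator (1 : Ω → ℝ) x) -
        fun x => ∑ e ∈ G.orderedEdges, (A e.1 ∩ A e.2).indicator (1 : Ω → ℝ) x) y ∂μ := by
    simp only [Pi.sub_apply]
    rw [integral_sub hvert hedge, integral_finsetSum _ fun i _ => hint _ (hA i),
      integral_finsetSum _ fun e _ => hint _ ((hA _).inter (hA _))]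
    simp only [integral_indicator_one (hA _), integral_indicator_one ((hA _).inter (hA _))]
    refine sub_le_sub ?_ ?_
    · simpa using Finset.card_nsmul_le_sum Finset.univ (fun i => μ.real (A i)) p fun i _ => hp i
    · calc _ ≤ (G.orderedEdges.card : ℝ) * q := by
            simpa using Finset.sum_le_card_nsmul G.orderedEdges
              (fun e => μ.real (A e.1 ∩ A e.2)) q
              fun e he => hpq _ _ (by simpa [orderedEdges] using (Finset.mem_filter.1 he).2.2)
        _ ≤ _ := by
            gcongr
            exact G.card_orderedEdges_le
  have hupper : ∑ i, (A i).indicator (1 : Ω → ℝ) x -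
      ∑ e ∈ G.orderedEdges, (A e.1 ∩ A e.2).indicator (1 : Ω → ℝ) x ≤ T.card := by
    have h : ((Finset.univ.filter fun i => x ∈ A i).card : ℝ) ≤ T.card +
        (G.orderedEdges.filter fun e => x ∈ A e.1 ∧ x ∈ A e.2).card := by
      exact_mod_cast by simpa using hcard
    simp only [Set.indicator_apply, Pi.one_apply, Finset.sum_boole, Set.mem_inter_iff]
    linarith
  exact hlower.trans (hx.trans hupper)

end SimpleGraph

/-- For large `D` there is a threshold balancing the vertex and edge terms. -/
lemma exists_gaussian_threshold {D : ℝ} (hD : rexp 10 ≤ D) :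
    ∃ c : ℝ, 1 ≤ c ∧ D * (rexp (-(2 * c ^ 2)) / c ^ 2) ≤
        rexp (-4) * (rexp (-(c ^ 2 / 2)) / c) ∧
      rexp (-(5 / 3)) / (D * Real.log D) ^ ((1 : ℝ) / 3) ≤ rexp (-(c ^ 2 / 2)) / c := by
  have hD0 : 0 < D := (exp_pos _).trans_le hD
  set L := Real.log D with hL
  have hL10 : 10 ≤ L := (Real.le_log_iff_exp_le hD0).2 hD
  have hL0 : 0 < L := by linarith
  have hDexp : D = rexp L := (Real.exp_log hD0).symm
  set l := Real.log L with hl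
  have hl0 : 0 ≤ l := Real.log_nonneg (by linarith)
  have hlL : l ≤ L := (Real.log_le_sub_one_of_pos hL0).trans (by linarith)
  have hLexp : L = rexp l := (Real.exp_log hL0).symm
  have hsq : √L = rexp (l / 2) := by
    rw [Real.exp_half, ← hLexp]
  set s := 2 / 3 * (L - l / 2 + 5) with hs
  have hcs : √s ^ 2 = s := Real.sq_sqrt (by linarith)
  have hs_lower : L / 4 ≤ s := by linarith
  have hc1 : 1 ≤ √s := by rw [Real.one_le_sqrt]; linarith
  have hc_upper : √s ≤ √L := Real.sqrt_le_sqrt (by linarith)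
  have hc_lower : √L / 2 ≤ √s := by
    refine Real.le_sqrt_of_sq_le ?_
    rw [div_pow, Real.sq_sqrt hL0.le]; linarith
  refine ⟨√s, hc1, ?_, ?_⟩
  · have hc0 : 0 < √s := by linarith
    have h1 : rexp (l / 2 - 1) ≤ √s := by
      refine le_trans ?_ hc_lower
      rw [hsq, Real.exp_sub]
      gcongr
      linarith [Real.add_one_le_exp (1 : ℝ)]
    have h2 : D * rexp (-(2 * s)) = rexp (-4) * rexp (-(s / 2)) * rexp (l / 2 - 1) := by
      rw [hDexp, ← Real.exp_add, ← Real.exp_add, ← Real.exp_add]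
      congr 1; rw [hs]; ring
    rw [hcs, mul_div_assoc', mul_div_assoc', h2, div_le_div_iff₀ (by linarith) hc0]
    calc _ ≤ rexp (-4) * rexp (-(s / 2)) * √s * √s := by gcongr
      _ = rexp (-4) * rexp (-(s / 2)) * s := by rw [mul_assoc, ← sq, hcs]
  · rw [hcs]
    calc rexp (-(5 / 3)) / (D * L) ^ ((1 : ℝ) / 3)
        = rexp (-(s / 2)) / √L := by
          rw [hsq, Real.rpow_def_of_pos (by positivity), Real.log_mul hD0.ne' hL0.ne', ← hL, ← hl,
            ← Real.exp_sub, ← Real.exp_sub]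
          congr 1; rw [hs]; ring
      _ ≤ _ := by gcongr

theorem stmt_4 : ∃ D₀ : ℝ, 1 < D₀ ∧ ∃ c₀ : ℝ, 0 < c₀ ∧
    ∀ (n : ℕ), 1 ≤ n → ∀ (G : SimpleGraph (Fin n)) (v : Fin n → (Fin n → ℝ)),
      (∀ i, ∑ k, (v i k) ^ 2 = 1) →
      (∀ i j, G.Adj i j → ∑ k, v i k * v j k ≤ -(1 / 2)) →
      ∀ D : ℝ, D = 2 * (Nat.card G.edgeSet : ℝ) / n →
        D₀ ≤ D →
        ∃ S : Finset (Fin n), (∀ i ∈ S, ∀ j ∈ S, ¬ G.Adj i j) ∧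
          c₀ * n / (D * Real.log D) ^ ((1 : ℝ) / 3) ≤ S.card := by
  classical
  refine ⟨rexp 10, Real.one_lt_exp_iff.2 (by norm_num), rexp (-4) * rexp (-(5 / 3)) / 2,
    by positivity, ?_⟩
  intro n hn G v hunit hadj D hDdef hD
  obtain ⟨c, hc, hbalance, hsize⟩ := exists_gaussian_threshold hD
  have hn0 : (0 : ℝ) < n := by exact_mod_cast hn
  let u : Fin n → EuclideanSpace ℝ (Fin n) := fun i => WithLp.toLp 2 (v i)
  have hu : ∀ i, ‖u i‖ = 1 := fun i => by
    simp [u, EuclideanSpace.norm_eq, hunit i]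
  have huu : ∀ i j, G.Adj i j → inner ℝ (u i) (u j) ≤ -(1 / 2) := fun i j h => by
    simpa [u, PiLp.inner_apply, mul_comm] using hadj i j h
  obtain ⟨S, hS, hcard⟩ := G.exists_independent_of_events
    (stdGaussian (EuclideanSpace ℝ (Fin n))) (fun i => {x | c ≤ inner ℝ (u i) x})
    (p := rexp (-4) * (rexp (-(c ^ 2 / 2)) / c)) (q := rexp (-(2 * c ^ 2)) / c ^ 2)
    (fun i => measurableSet_le (by fun_prop) (by fun_prop)) (by positivity)
    (fun i => by
      have h := map_inner_stdGaussian (u i)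
      rw [hu i, one_pow, Real.toNNReal_one] at h
      have h' := le_gaussianReal_Ici hc
      rw [← h, map_measureReal_apply (by fun_prop) measurableSet_Ici] at h'
      exact h')
    (fun i j h => ENNReal.toReal_le_of_le_ofReal (by positivity)
      (stdGaussian_inter_halfSpaces_le (hu i) (hu j) (huu i j h) (by linarith)))
  refine ⟨S, hS, le_trans ?_ hcard⟩
  have hE : (Nat.card G.edgeSet : ℝ) = n * D / 2 := by
    rw [hDdef]; field_simp
  rw [hE, Fintype.card_fin]
  calc rexp (-4) * rexp (-(5 / 3)) / 2 * n / (D * Real.log D) ^ ((1 : ℝ) / 3)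
      = n / 2 * (rexp (-4) * (rexp (-(5 / 3)) / (D * Real.log D) ^ ((1 : ℝ) / 3))) := by ring
    _ ≤ n / 2 * (rexp (-4) * (rexp (-(c ^ 2 / 2)) / c)) := by gcongr
    _ ≤ _ := by nlinarith [mul_le_mul_of_nonneg_left hbalance hn0.le]
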